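/- arXiv:0804.2707 — 6 statements merged into one kernel-verified Lean document; each statement's English description precedes it below -/
import Mathlib

section
/- Let F_i, F_j, F_k, F_l ∈ L⁴ be pairwise non-proportional null vectors satisfying the discrete Moutard equation F_k − F_i = t·(F_j − F_l) for some t ∈ ℝ, t ≠ 0. Then ⟨F_j,F_k⟩ = ⟨F_i,F_l⟩, ⟨F_k,F_l⟩ = ⟨F_i,F_j⟩, ⟨F_i,F_k⟩·⟨F_j,F_l⟩ = (⟨F_i,F_j⟩ − ⟨F_i,F_l⟩)², and F_k = Γ^q_{F_j,F_l}(F_i) with q = ⟨F_i,F_j⟩/⟨F_i,F_l⟩; that is, the four points lie on a common circle and their cross ratio equals ⟨F_i,F_j⟩/⟨F_i,F_l⟩. -/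
noncomputable section

/-- The Minkowski bilinear form of signature (4,1) on `ℝ^5`. -/
def mink (x y : Fin 5 → ℝ) : ℝ :=
  -(x 0 * y 0) + x 1 * y 1 + x 2 * y 2 + x 3 * y 3 + x 4 * y 4

/-- The light cone `L⁴ ⊂ ℝ^{4,1}`. -/
def LightCone (x : Fin 5 → ℝ) : Prop :=
  x ≠ 0 ∧ mink x x = 0

/-- The map `Γ^q_{p,p'}` of the paper. -/
def Gamma (p p' : Fin 5 → ℝ) (q : ℝ) (X : Fin 5 → ℝ) : Fin 5 → ℝ :=
  X + (1 / mink p p') •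
    (((q - 1) * mink X p') • p + ((1 / q - 1) * mink X p) • p')

/-- Two vectors are proportional if one is a scalar multiple of the other. -/
def Proportional (x y : Fin 5 → ℝ) : Prop :=
  (∃ t : ℝ, y = t • x) ∨ (∃ t : ℝ, x = t • y)

/-- Membership in the rectangular grid `M`. -/
def InGrid (m₁ m₂ n₁ n₂ : ℤ) (i : ℤ × ℤ) : Prop :=
  m₁ ≤ i.1 ∧ i.1 ≤ m₂ ∧ n₁ ≤ i.2 ∧ i.2 ≤ n₂

/-- `(i,j)` is an edge of the grid (in either orientation). -/
def IsEdge (m₁ m₂ n₁ n₂ : ℤ) (i j : ℤ × ℤ) : Prop :=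
  InGrid m₁ m₂ n₁ n₂ i ∧ InGrid m₁ m₂ n₁ n₂ j ∧
    ((j.1 = i.1 + 1 ∧ j.2 = i.2) ∨ (i.1 = j.1 + 1 ∧ i.2 = j.2) ∨
     (j.1 = i.1 ∧ j.2 = i.2 + 1) ∨ (i.1 = j.1 ∧ i.2 = j.2 + 1))

/-- `(i,j,k,l)` is an elementary quadrilateral (face) of the grid. -/
def IsFace (m₁ m₂ n₁ n₂ : ℤ) (i j k l : ℤ × ℤ) : Prop :=
  InGrid m₁ m₂ n₁ n₂ i ∧ InGrid m₁ m₂ n₁ n₂ k ∧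
    j = (i.1 + 1, i.2) ∧ k = (i.1 + 1, i.2 + 1) ∧ l = (i.1, i.2 + 1)

/-- Four vectors are pairwise non-proportional. -/
def FaceRegular (v w x y : Fin 5 → ℝ) : Prop :=
  ¬ Proportional v w ∧ ¬ Proportional v x ∧ ¬ Proportional v y ∧
  ¬ Proportional w x ∧ ¬ Proportional w y ∧ ¬ Proportional x y

/-- A discrete isothermic net (with values in the light cone) with cross ratio
factorizing function `a`. -/
structure IsIsothermic (m₁ m₂ n₁ n₂ : ℤ) (F : ℤ × ℤ → Fin 5 → ℝ)
    (a : ℤ × ℤ → ℤ × ℤ → ℝ) : Prop where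
  lightcone : ∀ i, InGrid m₁ m₂ n₁ n₂ i → LightCone (F i)
  regular : ∀ i j k l, IsFace m₁ m₂ n₁ n₂ i j k l →
    FaceRegular (F i) (F j) (F k) (F l)
  symm : ∀ i j, IsEdge m₁ m₂ n₁ n₂ i j → a i j = a j i
  nonzero : ∀ i j, IsEdge m₁ m₂ n₁ n₂ i j → a i j ≠ 0
  opposite : ∀ i j k l, IsFace m₁ m₂ n₁ n₂ i j k l →
    a i j = a l k ∧ a i l = a j k
  cross : ∀ i j k l, IsFace m₁ m₂ n₁ n₂ i j k l →
    ∃ t : ℝ, t ≠ 0 ∧ F k = t • Gamma (F j) (F l) (a i j / a i l) (F i)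

/-- Evaluation of the polynomial with vector coefficients `P i 0, …, P i N`
at the spectral parameter `lam`. -/
def pcqEval (N : ℕ) (P : ℤ × ℤ → ℕ → Fin 5 → ℝ) (i : ℤ × ℤ) (lam : ℝ) :
    Fin 5 → ℝ :=
  ∑ k ∈ Finset.range (N + 1), lam ^ k • P i k

/-- `P` is a polynomial conserved quantity of degree at most `N` of the net `F`
with cross ratio factorizing function `a`. -/
def IsPCQ (m₁ m₂ n₁ n₂ : ℤ) (F : ℤ × ℤ → Fin 5 → ℝ) (a : ℤ × ℤ → ℤ × ℤ → ℝ)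
    (N : ℕ) (P : ℤ × ℤ → ℕ → Fin 5 → ℝ) : Prop :=
  ∀ i j, IsEdge m₁ m₂ n₁ n₂ i j → ∀ lam : ℝ, lam * a i j ≠ 1 →
    pcqEval N P i lam = Gamma (F i) (F j) (1 - lam * a i j) (pcqEval N P j lam)

/-- A polynomial conserved quantity is normalized (of degree `N`) if its top
coefficient has Minkowski square norm one at every vertex. -/
def Normalized (m₁ m₂ n₁ n₂ : ℤ) (N : ℕ) (P : ℤ × ℤ → ℕ → Fin 5 → ℝ) : Prop :=
  ∀ i, InGrid m₁ m₂ n₁ n₂ i → mink (P i N) (P i N) = 1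

/-- A Darboux transform of `F` with parameter `μ`. -/
def IsDarboux (m₁ m₂ n₁ n₂ : ℤ) (F : ℤ × ℤ → Fin 5 → ℝ) (a : ℤ × ℤ → ℤ × ℤ → ℝ)
    (μ : ℝ) (Fh : ℤ × ℤ → Fin 5 → ℝ) : Prop :=
  (∀ i, InGrid m₁ m₂ n₁ n₂ i → LightCone (Fh i)) ∧
  (∀ i, InGrid m₁ m₂ n₁ n₂ i → ¬ Proportional (F i) (Fh i)) ∧
  (∀ i j, IsEdge m₁ m₂ n₁ n₂ i j → Fh i = Gamma (F i) (F j) (1 - μ * a i j) (Fh j))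

/-- A Calapso transformation of `F` at parameter `μ`: a vertexwise family of
linear isometries of `ℝ^{4,1}` gauging the isothermic connection at `μ` to the
trivial connection. -/
def IsCalapso (m₁ m₂ n₁ n₂ : ℤ) (F : ℤ × ℤ → Fin 5 → ℝ) (a : ℤ × ℤ → ℤ × ℤ → ℝ)
    (μ : ℝ) (T : ℤ × ℤ → (Fin 5 → ℝ) → (Fin 5 → ℝ)) : Prop :=
  (∀ i, InGrid m₁ m₂ n₁ n₂ i → IsLinearMap ℝ (T i)) ∧
  (∀ i, InGrid m₁ m₂ n₁ n₂ i → ∀ x y, mink (T i x) (T i y) = mink x y) ∧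
  (∀ i j, IsEdge m₁ m₂ n₁ n₂ i j → ∀ x,
    T j x = T i (Gamma (F i) (F j) (1 - μ * a i j) x))

theorem mink_ne_zero_aux (x y : Fin 5 → ℝ) (hx : LightCone x) (hy : LightCone y)
    (h : ¬ Proportional x y) : mink x y ≠ 0 := by
  intro h0
  have hx2 := hx.2
  have hy2 := hy.2
  unfold mink at hx2 hy2 h0
  have hx0 : x 0 ≠ 0 := by
    intro hz
    rw [hz] at hx2
    apply hx.1
    funext i
    fin_cases i
    · exact hz
    all_goals
      simp only [Pi.zero_apply]
      apply pow_eq_zero_iff (two_ne_zero) |>.1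
      simp
      nlinarith [sq_nonneg (x 1), sq_nonneg (x 2), sq_nonneg (x 3), sq_nonneg (x 4)]
  have key : (x 0 * y 1 - y 0 * x 1)^2 + (x 0 * y 2 - y 0 * x 2)^2
      + (x 0 * y 3 - y 0 * x 3)^2 + (x 0 * y 4 - y 0 * x 4)^2 = 0 := by
    linear_combination (x 0)^2 * hy2 + (y 0)^2 * hx2 - 2 * x 0 * y 0 * h0
  have k1 : x 0 * y 1 - y 0 * x 1 = 0 := by
    apply pow_eq_zero_iff (two_ne_zero) |>.1
    apply le_antisymm _ (sq_nonneg _)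
    linarith [sq_nonneg (x 0 * y 2 - y 0 * x 2), sq_nonneg (x 0 * y 3 - y 0 * x 3), sq_nonneg (x 0 * y 4 - y 0 * x 4)]
  have k2 : x 0 * y 2 - y 0 * x 2 = 0 := by
    apply pow_eq_zero_iff (two_ne_zero) |>.1
    apply le_antisymm _ (sq_nonneg _)
    linarith [sq_nonneg (x 0 * y 1 - y 0 * x 1), sq_nonneg (x 0 * y 3 - y 0 * x 3), sq_nonneg (x 0 * y 4 - y 0 * x 4)]
  have k3 : x 0 * y 3 - y 0 * x 3 = 0 := by
    apply pow_eq_zero_iff (two_ne_zero) |>.1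
    apply le_antisymm _ (sq_nonneg _)
    linarith [sq_nonneg (x 0 * y 1 - y 0 * x 1), sq_nonneg (x 0 * y 2 - y 0 * x 2), sq_nonneg (x 0 * y 4 - y 0 * x 4)]
  have k4 : x 0 * y 4 - y 0 * x 4 = 0 := by
    apply pow_eq_zero_iff (two_ne_zero) |>.1
    apply le_antisymm _ (sq_nonneg _)
    linarith [sq_nonneg (x 0 * y 1 - y 0 * x 1), sq_nonneg (x 0 * y 2 - y 0 * x 2), sq_nonneg (x 0 * y 3 - y 0 * x 3)]
  apply h
  left
  refine ⟨y 0 / x 0, ?_⟩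
  funext i
  fin_cases i <;> simp <;> field_simp <;> linarith

/-- four pairwise non-proportional null vectors satisfying a
discrete Moutard equation are concircular with cross ratio
`⟨F_i,F_j⟩ / ⟨F_i,F_l⟩`. -/
theorem statement0 (Fi Fj Fk Fl : Fin 5 → ℝ)
    (hFi : LightCone Fi) (hFj : LightCone Fj) (hFk : LightCone Fk)
    (hFl : LightCone Fl)
    (hij : ¬ Proportional Fi Fj) (hik : ¬ Proportional Fi Fk)
    (hil : ¬ Proportional Fi Fl) (hjk : ¬ Proportional Fj Fk)
    (hjl : ¬ Proportional Fj Fl) (hkl : ¬ Proportional Fk Fl)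
    (t : ℝ) (ht : t ≠ 0) (hMoutard : Fk - Fi = t • (Fj - Fl)) :
    mink Fj Fk = mink Fi Fl ∧
    mink Fk Fl = mink Fi Fj ∧
    mink Fi Fk * mink Fj Fl = (mink Fi Fj - mink Fi Fl) ^ 2 ∧
    Fk = Gamma Fj Fl (mink Fi Fj / mink Fi Fl) Fi := by
  have hkeq : ∀ n, Fk n = Fi n + t * (Fj n - Fl n) := by
    intro n
    have := congrFun hMoutard n
    simp only [Pi.sub_apply, Pi.smul_apply, smul_eq_mul] at this
    linarith
  have nij := mink_ne_zero_aux _ _ hFi hFj hij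
  have nil := mink_ne_zero_aux _ _ hFi hFl hil
  have njl := mink_ne_zero_aux _ _ hFj hFl hjl
  have ejj := hFj.2
  have ell := hFl.2
  have eii := hFi.2
  have ekk := hFk.2
  have main : mink Fi Fj - mink Fi Fl = t * mink Fj Fl := by
    apply mul_left_cancel₀ ht
    unfold mink at *
    simp only [hkeq] at ekk
    linear_combination (1/2) * ekk - (1/2) * eii - (1/2) * t^2 * ejj - (1/2) * t^2 * ell
  have e1 : mink Fj Fk = mink Fi Fj + t * mink Fj Fj - t * mink Fj Fl := by
    unfold mink; simp only [hkeq]; ring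
  have e2 : mink Fk Fl = mink Fi Fl + t * mink Fj Fl - t * mink Fl Fl := by
    unfold mink; simp only [hkeq]; ring
  have e3 : mink Fi Fk = mink Fi Fi + t * mink Fi Fj - t * mink Fi Fl := by
    unfold mink; simp only [hkeq]; ring
  refine ⟨?_, ?_, ?_, ?_⟩
  · rw [e1, ejj]; linarith
  · rw [e2, ell]; linarith
  · rw [e3, eii]
    linear_combination (-(mink Fi Fj - mink Fi Fl)) * main
  · funext n
    rw [hkeq n]
    simp only [Gamma, Pi.add_apply, Pi.smul_apply, smul_eq_mul]
    have ht' : t = (mink Fi Fj - mink Fi Fl) / mink Fj Fl := by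
      rw [main]; field_simp
    rw [ht']
    field_simp
    ring
end
end

section
/- Let F : M → L⁴ be a regular discrete net on a rectangular grid and let a be a nowhere-zero edge function. Then the isothermic family of connections Γ^λ_{ij} = Γ^{1−λ·a_{ij}}_{F_i,F_j} is flat (i.e. has trivial holonomy around every face, for every λ ∈ ℝ with λ·a_{ij} ≠ 1 on all edges) if and only if F is discrete isothermic with cross ratio factorizing function a. -/
noncomputable section

set_option linter.unusedSimpArgs false
set_option linter.all false

lemma mink_comm' (x y : Fin 5 → ℝ) : mink x y = mink y x := by
  unfold mink; ring

lemma mink_add_l (x y z : Fin 5 → ℝ) : mink (x + y) z = mink x z + mink y z := by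
  simp only [mink, Pi.add_apply]; ring

lemma mink_smul_l (c : ℝ) (x z : Fin 5 → ℝ) : mink (c • x) z = c * mink x z := by
  simp only [mink, Pi.smul_apply, smul_eq_mul]; ring

lemma mink_ne_zero {p q : Fin 5 → ℝ} (hp : LightCone p) (hq : LightCone q)
    (h : ¬ Proportional p q) : mink p q ≠ 0 := by
  intro h0
  obtain ⟨hp0, hp⟩ := hp
  obtain ⟨hq0, hq⟩ := hq
  have key : ∀ c, p 0 * q c - q 0 * p c = 0 := by
    have hs : (p 0 * q 1 - q 0 * p 1)^2 + (p 0 * q 2 - q 0 * p 2)^2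
      + (p 0 * q 3 - q 0 * p 3)^2 + (p 0 * q 4 - q 0 * p 4)^2 = 0 := by
      unfold mink at *
      linear_combination (p 0)^2 * hq + (q 0)^2 * hp - 2 * p 0 * q 0 * h0
    have h1 : p 0 * q 1 - q 0 * p 1 = 0 := by
      apply pow_eq_zero_iff (two_ne_zero) |>.1; nlinarith [sq_nonneg (p 0 * q 1 - q 0 * p 1), sq_nonneg (p 0 * q 2 - q 0 * p 2), sq_nonneg (p 0 * q 3 - q 0 * p 3), sq_nonneg (p 0 * q 4 - q 0 * p 4)]
    have h2 : p 0 * q 2 - q 0 * p 2 = 0 := by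
      apply pow_eq_zero_iff (two_ne_zero) |>.1; nlinarith [sq_nonneg (p 0 * q 1 - q 0 * p 1), sq_nonneg (p 0 * q 2 - q 0 * p 2), sq_nonneg (p 0 * q 3 - q 0 * p 3), sq_nonneg (p 0 * q 4 - q 0 * p 4)]
    have h3 : p 0 * q 3 - q 0 * p 3 = 0 := by
      apply pow_eq_zero_iff (two_ne_zero) |>.1; nlinarith [sq_nonneg (p 0 * q 1 - q 0 * p 1), sq_nonneg (p 0 * q 2 - q 0 * p 2), sq_nonneg (p 0 * q 3 - q 0 * p 3), sq_nonneg (p 0 * q 4 - q 0 * p 4)]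
    have h4 : p 0 * q 4 - q 0 * p 4 = 0 := by
      apply pow_eq_zero_iff (two_ne_zero) |>.1; nlinarith [sq_nonneg (p 0 * q 1 - q 0 * p 1), sq_nonneg (p 0 * q 2 - q 0 * p 2), sq_nonneg (p 0 * q 3 - q 0 * p 3), sq_nonneg (p 0 * q 4 - q 0 * p 4)]
    intro c
    fin_cases c
    · simp; ring
    · exact h1
    · exact h2
    · exact h3
    · exact h4
  have hp00 : p 0 ≠ 0 := by
    intro h00
    apply hp0
    unfold mink at hp
    rw [h00] at hp
    funext c
    fin_cases c
    · exact h00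
    all_goals
      simp
      apply pow_eq_zero_iff (two_ne_zero) |>.1
      nlinarith [sq_nonneg (p 1), sq_nonneg (p 2), sq_nonneg (p 3), sq_nonneg (p 4)]
  apply h
  left
  refine ⟨q 0 / p 0, ?_⟩
  funext c
  have := key c
  simp only [Pi.smul_apply, smul_eq_mul]
  field_simp
  linarith

lemma Gamma_inv {p p' : Fin 5 → ℝ} {q : ℝ} (hq : q ≠ 0) (hp : mink p p = 0)
    (hp' : mink p' p' = 0) (h : mink p p' ≠ 0) (X : Fin 5 → ℝ) :
    Gamma p' p q (Gamma p p' q X) = X := by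
  have e := mink_comm' p' p
  funext c
  simp only [Gamma, mink_add_l, mink_smul_l, Pi.add_apply, Pi.smul_apply, smul_eq_mul, hp, hp', e]
  field_simp
  ring

lemma face_fwd {v1 v2 v3 v4 : Fin 5 → ℝ} {a b1 a2 b : ℝ}
    (n1 : mink v1 v1 = 0) (n2 : mink v2 v2 = 0) (n3 : mink v3 v3 = 0) (n4 : mink v4 v4 = 0)
    (g12 : mink v1 v2 ≠ 0) (g13 : mink v1 v3 ≠ 0) (g14 : mink v1 v4 ≠ 0)
    (g23 : mink v2 v3 ≠ 0) (g24 : mink v2 v4 ≠ 0) (g34 : mink v3 v4 ≠ 0)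
    (ha : a ≠ 0) (hb : b ≠ 0)
    (S : Set ℝ) (hS : Dense S) (hSa : ∀ x ∈ S, x * a ≠ 1) (hSb : ∀ x ∈ S, x * b ≠ 1)
    (hSa2 : ∀ x ∈ S, x * a2 ≠ 1) (hSb1 : ∀ x ∈ S, x * b1 ≠ 1)
    (H : ∀ x ∈ S, Gamma v1 v2 (1 - x * a) (Gamma v2 v3 (1 - x * b1) v3)
       = Gamma v1 v4 (1 - x * b) (Gamma v4 v3 (1 - x * a2) v3)) :
    a = a2 ∧ b = b1 ∧ ∃ t : ℝ, t ≠ 0 ∧ v3 = t • Gamma v2 v4 (a / b) v1 := by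
  have e21 := mink_comm' v2 v1
  have e31 := mink_comm' v3 v1
  have e41 := mink_comm' v4 v1
  have e32 := mink_comm' v3 v2
  have e42 := mink_comm' v4 v2
  have e43 := mink_comm' v4 v3
  have D : ∀ x ∈ S, (1 - x * a) * (1 - x * b1) = (1 - x * b) * (1 - x * a2) := by
    intro x hx
    have A1 : 1 - x * a ≠ 0 := fun h => hSa x hx (by linarith)
    have A2 : 1 - x * b1 ≠ 0 := fun h => hSb1 x hx (by linarith)
    have A3 : 1 - x * b ≠ 0 := fun h => hSb x hx (by linarith)
    have A4 : 1 - x * a2 ≠ 0 := fun h => hSa2 x hx (by linarith)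
    have := congrArg (fun Y => mink Y v1) (H x hx)
    simp only [Gamma, mink_add_l, mink_smul_l, n1, n2, n3, n4, e21, e31, e41, e32, e42, e43] at this
    generalize 1 - x * a = A at *
    generalize 1 - x * b1 = B at *
    generalize 1 - x * b = C at *
    generalize 1 - x * a2 = E at *
    field_simp at this
    have h0 : (mink v1 v2 * mink v1 v3 * mink v1 v4 * mink v2 v3 * mink v3 v4) * (A * B)
        = (mink v1 v2 * mink v1 v3 * mink v1 v4 * mink v2 v3 * mink v3 v4) * (C * E) := by
      linear_combination -this
    exact mul_left_cancel₀ (by positivity) h0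
  have V : ∀ c, ∀ x ∈ S,
      (1 - x * a) * v3 c + (1 / mink v1 v2) * (-(x * a) * (1 - x * a) * mink v2 v3 * v1 c + x * a * mink v1 v3 * v2 c)
      = (1 - x * b) * v3 c + (1 / mink v1 v4) * (-(x * b) * (1 - x * b) * mink v3 v4 * v1 c + x * b * mink v1 v3 * v4 c) := by
    intro c x hx
    have A1 : 1 - x * a ≠ 0 := fun h => hSa x hx (by linarith)
    have A2 : 1 - x * b1 ≠ 0 := fun h => hSb1 x hx (by linarith)
    have A3 : 1 - x * b ≠ 0 := fun h => hSb x hx (by linarith)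
    have A4 : 1 - x * a2 ≠ 0 := fun h => hSa2 x hx (by linarith)
    have hD := D x hx
    have q3 : ∀ (p : Fin 5 → ℝ) (q : ℝ), q ≠ 0 → mink p v3 ≠ 0 → Gamma p v3 q v3 = (1 / q) • v3 := by
      intro p q hq hp
      funext c
      simp only [Gamma, Pi.add_apply, Pi.smul_apply, smul_eq_mul, n3, mink_comm' v3 p]
      field_simp
      ring
    have := H x hx
    rw [q3 _ _ A2 g23, q3 _ _ A4 (by rwa [e43])] at this
    have := congrFun this c
    simp only [Gamma, mink_smul_l, Pi.add_apply, Pi.smul_apply, smul_eq_mul, e31, e32] at this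
    have t1 : x * a = 1 - (1 - x * a) := by ring
    have t2 : x * b = 1 - (1 - x * b) := by ring
    generalize hA : 1 - x * a = A at *
    generalize 1 - x * b1 = B at *
    generalize hC : 1 - x * b = C at *
    generalize 1 - x * a2 = E at *
    rw [t1, t2]
    have l1 : (A * B) * (1 / B * v3 c + 1 / mink v1 v2 * ((A - 1) * (1 / B * mink v2 v3) * v1 c + (1 / A - 1) * (1 / B * mink v1 v3) * v2 c)) = A * v3 c + (1 / mink v1 v2) * (-(1 - A) * A * mink v2 v3 * v1 c + (1 - A) * mink v1 v3 * v2 c) := by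
      field_simp
      ring
    have l2 : (C * E) * (1 / E * v3 c + 1 / mink v1 v4 * ((C - 1) * (1 / E * mink v3 v4) * v1 c + (1 / C - 1) * (1 / E * mink v1 v3) * v4 c)) = C * v3 c + (1 / mink v1 v4) * (-(1 - C) * C * mink v3 v4 * v1 c + (1 - C) * mink v1 v3 * v4 c) := by
      field_simp
      ring
    rw [← l1, ← l2, this, hD]
  have D' : ∀ x : ℝ, (1 - x * a) * (1 - x * b1) = (1 - x * b) * (1 - x * a2) := by
    have := Continuous.ext_on hS (f := fun x : ℝ => (1 - x * a) * (1 - x * b1))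
      (g := fun x : ℝ => (1 - x * b) * (1 - x * a2)) (by fun_prop) (by fun_prop) D
    exact fun x => congrFun this x
  have V' : ∀ c, ∀ x : ℝ,
      (1 - x * a) * v3 c + (1 / mink v1 v2) * (-(x * a) * (1 - x * a) * mink v2 v3 * v1 c + x * a * mink v1 v3 * v2 c)
      = (1 - x * b) * v3 c + (1 / mink v1 v4) * (-(x * b) * (1 - x * b) * mink v3 v4 * v1 c + x * b * mink v1 v3 * v4 c) := by
    intro c
    have := Continuous.ext_on hS (f := fun x : ℝ => (1 - x * a) * v3 c + (1 / mink v1 v2) * (-(x * a) * (1 - x * a) * mink v2 v3 * v1 c + x * a * mink v1 v3 * v2 c))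
      (g := fun x : ℝ => (1 - x * b) * v3 c + (1 / mink v1 v4) * (-(x * b) * (1 - x * b) * mink v3 v4 * v1 c + x * b * mink v1 v3 * v4 c)) (by fun_prop) (by fun_prop) (V c)
    exact fun x => congrFun this x
  have Q : a ^ 2 * mink v2 v3 / mink v1 v2 = b ^ 2 * mink v3 v4 / mink v1 v4 := by
    have hne : ∃ c, v1 c ≠ 0 := by
      by_contra! hcon
      apply g12
      simp [mink, hcon]
    obtain ⟨c, hc⟩ := hne
    apply mul_right_cancel₀ hc
    linear_combination (1/2) * V' c 1 + (1/2) * V' c (-1)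
  have L : ∀ c, (a - b) * v3 c = -(a * mink v2 v3 / mink v1 v2 - b * mink v3 v4 / mink v1 v4) * v1 c
      + (a * mink v1 v3 / mink v1 v2) * v2 c + (- (b * mink v1 v3 / mink v1 v4)) * v4 c := by
    intro c
    linear_combination (-1/2) * V' c 1 + (1/2) * V' c (-1)
  have L4 : (a - b) * mink v3 v4 = -(a * mink v2 v3 / mink v1 v2 - b * mink v3 v4 / mink v1 v4) * mink v1 v4
      + (a * mink v1 v3 / mink v1 v2) * mink v2 v4 := by
    have hL : (a - b) • v3 = (-(a * mink v2 v3 / mink v1 v2 - b * mink v3 v4 / mink v1 v4)) • v1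
      + (a * mink v1 v3 / mink v1 v2) • v2 + (- (b * mink v1 v3 / mink v1 v4)) • v4 := funext L
    have := congrArg (fun Y => mink Y v4) hL
    simp only [mink_add_l, mink_smul_l, n4, mul_zero, add_zero] at this
    exact this
  have Q' : mink v2 v3 = b ^ 2 * mink v3 v4 * mink v1 v2 / (a ^ 2 * mink v1 v4) := by
    field_simp at Q ⊢
    linear_combination Q
  have R : mink v1 v3 = mink v1 v2 * mink v3 v4 * (a - b) ^ 2 / (a ^ 2 * mink v2 v4) := by
    rw [Q'] at L4
    field_simp at L4 ⊢
    linear_combination -L4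
  have hab : a ≠ b := by
    rintro rfl
    apply g13
    rw [R]
    simp
  have hab' : a - b ≠ 0 := sub_ne_zero.2 hab
  have s1 := D' 1
  have s2 := D' (-1)
  have s3 : a + b1 = b + a2 := by linarith
  have s4 : a * b1 = b * a2 := by linarith
  have hb1 : (a - b) * (b1 - b) = 0 := by linear_combination s4 - b * s3
  have hb1' : b1 = b := by
    rcases mul_eq_zero.1 hb1 with h | h
    · exact absurd h hab'
    · linarith
  refine ⟨by linarith, hb1'.symm, b * mink v3 v4 / (a * mink v1 v4), ?_, ?_⟩
  · exact div_ne_zero (mul_ne_zero hb g34) (mul_ne_zero ha g14)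
  · funext c
    apply mul_left_cancel₀ hab'
    rw [L c, Q', R]
    simp only [Gamma, Pi.add_apply, Pi.smul_apply, smul_eq_mul]
    field_simp
    ring

lemma face_bwd {v1 v2 v3 v4 : Fin 5 → ℝ} {a b t : ℝ}
    (n1 : mink v1 v1 = 0) (n2 : mink v2 v2 = 0) (n4 : mink v4 v4 = 0)
    (g12 : mink v1 v2 ≠ 0) (g14 : mink v1 v4 ≠ 0) (g24 : mink v2 v4 ≠ 0)
    (hab : a ≠ b) (ht : t ≠ 0)
    (ha : a ≠ 0) (hb : b ≠ 0) (x : ℝ) (hxa : x * a ≠ 1) (hxb : x * b ≠ 1)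
    (h3 : v3 = t • Gamma v2 v4 (a / b) v1) (X : Fin 5 → ℝ) :
    Gamma v1 v2 (1 - x * a) (Gamma v2 v3 (1 - x * b) X)
       = Gamma v1 v4 (1 - x * b) (Gamma v4 v3 (1 - x * a) X) := by
  have e21 := mink_comm' v2 v1
  have e41 := mink_comm' v4 v1
  have e42 := mink_comm' v4 v2
  have A1 : 1 - x * a ≠ 0 := fun h => hxa (by linarith)
  have A3 : 1 - x * b ≠ 0 := fun h => hxb (by linarith)
  have h32 : mink v2 v3 = t * (b / a) * mink v1 v2 * 1 := by
    rw [mink_comm', h3]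
    simp only [Gamma, mink_add_l, mink_smul_l, n1, n2, n4, e21, e41, e42]
    field_simp
    ring
  have h34 : mink v4 v3 = t * (a / b) * mink v1 v4 := by
    rw [mink_comm', h3]
    simp only [Gamma, mink_add_l, mink_smul_l, n1, n2, n4, e21, e41, e42]
    field_simp
    ring
  have h31 : mink v3 v1 = t * (a - b)^2 / (a * b) * mink v1 v2 * mink v1 v4 / mink v2 v4 := by
    rw [h3]
    simp only [Gamma, mink_add_l, mink_smul_l, n1, n2, n4, e21, e41, e42]
    field_simp
    ring
  have hX3 : mink X v3 = t * (mink X v1 + (1 / mink v2 v4) * ((a/b-1) * mink v1 v4 * mink X v2 + (b/a-1) * mink v1 v2 * mink X v4)) := by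
    rw [mink_comm', h3]
    simp only [Gamma, mink_add_l, mink_smul_l, n1, n2, n4, e21, e41, e42]
    rw [mink_comm' X v1, mink_comm' X v2, mink_comm' X v4]
    field_simp
  funext c
  have hc : v3 c = t * (v1 c + (1 / mink v2 v4) * ((a/b-1) * mink v1 v4 * v2 c + (b/a-1) * mink v1 v2 * v4 c)) := by
    rw [h3]
    simp only [Gamma, Pi.add_apply, Pi.smul_apply, smul_eq_mul]
    field_simp
  clear h3
  simp only [Gamma, mink_add_l, mink_smul_l, Pi.add_apply, Pi.smul_apply, smul_eq_mul, n1, n2, n4, e21, e41, e42, h31, h32, h34, hX3, mink_comm' v3 v2, mink_comm' v3 v4, hc]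
  generalize mink X v1 = x1
  generalize mink X v2 = x2
  generalize mink X v4 = x4
  generalize mink v1 v2 = g12 at *
  generalize mink v1 v4 = g14 at *
  generalize mink v2 v4 = g24 at *
  generalize v1 c = w1
  generalize v2 c = w2
  generalize v4 c = w4
  have hab' := sub_ne_zero.2 hab
  have A1' : 1 - a * x ≠ 0 := by rwa [mul_comm]
  have A3' : 1 - b * x ≠ 0 := by rwa [mul_comm]
  field_simp
  ring

/-- the isothermic family of connections of a regular net with an
edge function `a` is flat if and only if the net is discrete isothermic with
cross ratio factorizing function `a`. -/
theorem statement1 (m₁ m₂ n₁ n₂ : ℤ) (F : ℤ × ℤ → Fin 5 → ℝ)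
    (a : ℤ × ℤ → ℤ × ℤ → ℝ)
    (hlc : ∀ i, InGrid m₁ m₂ n₁ n₂ i → LightCone (F i))
    (hreg : ∀ i j k l, IsFace m₁ m₂ n₁ n₂ i j k l →
      FaceRegular (F i) (F j) (F k) (F l))
    (hsymm : ∀ i j, IsEdge m₁ m₂ n₁ n₂ i j → a i j = a j i)
    (hnz : ∀ i j, IsEdge m₁ m₂ n₁ n₂ i j → a i j ≠ 0) :
    (∀ lam : ℝ, (∀ i j, IsEdge m₁ m₂ n₁ n₂ i j → lam * a i j ≠ 1) →
      ∀ i j k l, IsFace m₁ m₂ n₁ n₂ i j k l → ∀ X : Fin 5 → ℝ,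
        Gamma (F i) (F j) (1 - lam * a i j)
          (Gamma (F j) (F k) (1 - lam * a j k)
            (Gamma (F k) (F l) (1 - lam * a k l)
              (Gamma (F l) (F i) (1 - lam * a l i) X))) = X)
    ↔ IsIsothermic m₁ m₂ n₁ n₂ F a := by
  have grid : ∀ {i j k l}, IsFace m₁ m₂ n₁ n₂ i j k l →
      IsEdge m₁ m₂ n₁ n₂ i j ∧ IsEdge m₁ m₂ n₁ n₂ j k ∧ IsEdge m₁ m₂ n₁ n₂ k l ∧ IsEdge m₁ m₂ n₁ n₂ l i
      ∧ InGrid m₁ m₂ n₁ n₂ i ∧ InGrid m₁ m₂ n₁ n₂ j ∧ InGrid m₁ m₂ n₁ n₂ k ∧ InGrid m₁ m₂ n₁ n₂ l := by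
    rintro ⟨i1, i2⟩ j k l ⟨hi, hk, rfl, rfl, rfl⟩
    simp only [IsEdge, InGrid] at *
    refine ⟨?_, ?_, ?_, ?_, ?_, ?_, ?_, ?_⟩ <;> (try simp only [true_and, and_true, true_or, or_true]) <;> first | omega | (refine ⟨by omega, by omega, ?_⟩; first | (left; constructor <;> omega) | (right; left; constructor <;> omega) | (right; right; left; constructor <;> omega) | (right; right; right; constructor <;> omega))
  have gs : ∀ {i j k l}, IsFace m₁ m₂ n₁ n₂ i j k l →
      mink (F i) (F j) ≠ 0 ∧ mink (F i) (F k) ≠ 0 ∧ mink (F i) (F l) ≠ 0 ∧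
      mink (F j) (F k) ≠ 0 ∧ mink (F j) (F l) ≠ 0 ∧ mink (F k) (F l) ≠ 0 := by
    intro i j k l hf
    obtain ⟨-, -, -, -, hi, hj, hk, hl⟩ := grid hf
    obtain ⟨h1, h2, h3, h4, h5, h6⟩ := hreg i j k l hf
    exact ⟨mink_ne_zero (hlc i hi) (hlc j hj) h1, mink_ne_zero (hlc i hi) (hlc k hk) h2,
      mink_ne_zero (hlc i hi) (hlc l hl) h3, mink_ne_zero (hlc j hj) (hlc k hk) h4,
      mink_ne_zero (hlc j hj) (hlc l hl) h5, mink_ne_zero (hlc k hk) (hlc l hl) h6⟩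
  constructor
  · intro H
    have hface : ∀ i j k l, IsFace m₁ m₂ n₁ n₂ i j k l →
        a i j = a l k ∧ a i l = a j k ∧
          ∃ t : ℝ, t ≠ 0 ∧ F k = t • Gamma (F j) (F l) (a i j / a i l) (F i) := by
      intro i j k l hf
      obtain ⟨eij, ejk, ekl, eli, hi, hj, hk, hl⟩ := grid hf
      obtain ⟨g12, g13, g14, g23, g24, g34⟩ := gs hf
      have sil : a l i = a i l := hsymm _ _ eli
      have skl : a k l = a l k := hsymm _ _ ekl
      let S : Set ℝ := {x | ∀ i j, IsEdge m₁ m₂ n₁ n₂ i j → x * a i j ≠ 1}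
      have hS : Dense S := by
        have hfin : (Set.image2 (fun i j => (a i j)⁻¹)
            (Set.Icc m₁ m₂ ×ˢ Set.Icc n₁ n₂) (Set.Icc m₁ m₂ ×ˢ Set.Icc n₁ n₂)).Finite :=
          Set.Finite.image2 _ ((Set.finite_Icc _ _).prod (Set.finite_Icc _ _))
            ((Set.finite_Icc _ _).prod (Set.finite_Icc _ _))
        refine (Set.Countable.dense_compl ℝ hfin.countable).mono ?_
        intro x hx i j he hxa
        apply hx
        obtain ⟨⟨p1, p2, p3, p4⟩, ⟨r1, r2, r3, r4⟩, -⟩ := he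
        exact ⟨i, ⟨⟨p1, p2⟩, ⟨p3, p4⟩⟩, j, ⟨⟨r1, r2⟩, ⟨r3, r4⟩⟩, (eq_inv_of_mul_eq_one_left hxa).symm⟩
      refine face_fwd (b1 := a j k) (hlc i hi).2 (hlc j hj).2 (hlc k hk).2 (hlc l hl).2 g12 g13 g14 g23 g24 g34
        (hnz _ _ eij) (sil ▸ hnz _ _ eli) S hS (fun x hx => hx _ _ eij) (fun x hx => sil ▸ hx _ _ eli)
        (fun x hx => skl ▸ hx _ _ ekl) (fun x hx => hx _ _ ejk) ?_
      intro x hx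
      have A3 : 1 - x * a i l ≠ 0 := fun h => hx _ _ eli (by rw [sil]; linarith)
      have A4 : 1 - x * a l k ≠ 0 := fun h => hx _ _ ekl (by rw [skl]; linarith)
      have h := H x hx i j k l hf (Gamma (F i) (F l) (1 - x * a i l) (Gamma (F l) (F k) (1 - x * a l k) (F k)))
      rw [sil, skl, Gamma_inv A3 (hlc i hi).2 (hlc l hl).2 g14,
        Gamma_inv A4 (hlc l hl).2 (hlc k hk).2 (by rwa [mink_comm'])] at h
      exact h
    exact ⟨hlc, hreg, hsymm, hnz, fun i j k l hf => ⟨(hface i j k l hf).1, (hface i j k l hf).2.1⟩,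
      fun i j k l hf => (hface i j k l hf).2.2⟩
  · intro H x hx i j k l hf X
    obtain ⟨eij, ejk, ekl, eli, hi, hj, hk, hl⟩ := grid hf
    obtain ⟨g12, g13, g14, g23, g24, g34⟩ := gs hf
    have sil : a l i = a i l := hsymm _ _ eli
    have skl : a k l = a l k := hsymm _ _ ekl
    obtain ⟨o1, o2⟩ := H.opposite i j k l hf
    obtain ⟨t, ht, h3⟩ := H.cross i j k l hf
    have A1 : x * a i j ≠ 1 := hx _ _ eij
    have A3 : x * a i l ≠ 1 := sil ▸ hx _ _ eli
    have a0 : a i j ≠ 0 := hnz _ _ eij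
    have b0 : a i l ≠ 0 := sil ▸ hnz _ _ eli
    have hab : a i j ≠ a i l := by
      intro hab
      apply (hreg i j k l hf).2.1
      left
      refine ⟨t, ?_⟩
      rw [h3, hab, div_self b0]
      simp [Gamma]
    rw [sil, skl, ← o1, ← o2]
    rw [face_bwd (hlc i hi).2 (hlc j hj).2 (hlc l hl).2 g12 g14 g24 hab ht a0 b0 x A1 A3 h3]
    have B1 : 1 - x * a i j ≠ 0 := fun h => A1 (by linarith)
    have B3 : 1 - x * a i l ≠ 0 := fun h => A3 (by linarith)
    rw [Gamma_inv B1 (hlc k hk).2 (hlc l hl).2 g34,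
      Gamma_inv B3 (hlc l hl).2 (hlc i hi).2 (by rwa [mink_comm'])]
end
end

section
/- Let P be a polynomial conserved quantity of degree ≤ N of a discrete isothermic net F with cross ratio factorizing function a, and let μ ∈ ℝ satisfy μ·a_{ij} ≠ 1 on all edges. If P_i(μ) = 0 at one vertex i, then P_j(μ) = 0 at every vertex j; and in that case there is a polynomial conserved quantity P̃ of F of degree ≤ N−1 with P_i(λ) = (λ−μ)·P̃_i(λ) for all i and all λ, i.e. P(λ)/(λ−μ) is a polynomial conserved quantity of lower degree. -/
noncomputable section

theorem aux_div (μ : ℝ) (N : ℕ) : ∀ c : ℕ → Fin 5 → ℝ, ∃ (d : ℕ → Fin 5 → ℝ) (r : Fin 5 → ℝ),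
    ∀ lam : ℝ, ∑ k ∈ Finset.range (N + 1), lam ^ k • c k =
      (lam - μ) • (∑ k ∈ Finset.range N, lam ^ k • d k) + r := by
  induction N with
  | zero => intro c; exact ⟨0, c 0, fun lam => by simp⟩
  | succ n ih =>
    intro c
    obtain ⟨d, r, h⟩ := ih (fun k => c (k + 1))
    refine ⟨fun k => Nat.casesOn k r d, c 0 + μ • r, fun lam => ?_⟩
    rw [Finset.sum_range_succ' _ (n + 1), Finset.sum_range_succ' (fun k => lam ^ k • (Nat.casesOn k r d : Fin 5 → ℝ)) n]
    have e1 : ∑ k ∈ Finset.range (n + 1), lam ^ (k + 1) • c (k + 1)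
        = lam • ∑ k ∈ Finset.range (n + 1), lam ^ k • c (k + 1) := by
      rw [Finset.smul_sum]
      exact Finset.sum_congr rfl fun k _ => by rw [smul_smul, pow_succ']
    have e2 : ∑ k ∈ Finset.range n, lam ^ (k + 1) • d k
        = lam • ∑ k ∈ Finset.range n, lam ^ k • d k := by
      rw [Finset.smul_sum]
      exact Finset.sum_congr rfl fun k _ => by rw [smul_smul, pow_succ']
    rw [e1, h lam]
    simp only [e2]
    module

theorem mink_smul_left (t : ℝ) (x y : Fin 5 → ℝ) : mink (t • x) y = t * mink x y := by
  simp only [mink, Pi.smul_apply, smul_eq_mul]; ring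

theorem Gamma_smul (p p' : Fin 5 → ℝ) (q t : ℝ) (X : Fin 5 → ℝ) :
    Gamma p p' q (t • X) = t • Gamma p p' q X := by
  simp only [Gamma, mink_smul_left]; module

theorem Gamma_zero (p p' : Fin 5 → ℝ) (q : ℝ) : Gamma p p' q 0 = 0 := by
  have := Gamma_smul p p' q 0 0
  simpa using this

theorem pcqEval_cont (N : ℕ) (P : ℤ × ℤ → ℕ → Fin 5 → ℝ) (i : ℤ × ℤ) :
    Continuous (pcqEval N P i) := by
  unfold pcqEval; fun_prop

theorem aux_van (m₁ m₂ n₁ n₂ : ℤ) (V : ℤ × ℤ → Prop)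
    (hV : ∀ i j, IsEdge m₁ m₂ n₁ n₂ i j → V j → V i)
    (i₀ : ℤ × ℤ) (hi₀ : InGrid m₁ m₂ n₁ n₂ i₀) (h0 : V i₀) :
    ∀ (n : ℕ) (j : ℤ × ℤ), InGrid m₁ m₂ n₁ n₂ j →
      (j.1 - i₀.1).natAbs + (j.2 - i₀.2).natAbs = n → V j := by
  intro n
  induction n with
  | zero =>
    intro j _ h
    have : j = i₀ := Prod.ext (by omega) (by omega)
    rwa [this]
  | succ n ih =>
    rintro ⟨x, y⟩ hj h
    obtain ⟨u, v⟩ := i₀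
    simp only [InGrid] at *
    have key : ∃ k : ℤ × ℤ, IsEdge m₁ m₂ n₁ n₂ (x, y) k ∧
        (k.1 - u).natAbs + (k.2 - v).natAbs = n := by
      rcases lt_trichotomy x u with hx | hx | hx
      · refine ⟨(x + 1, y), ?_, ?_⟩ <;> simp only [IsEdge, InGrid, and_true, true_and, and_self, true_or, or_true] <;> omega
      · rcases lt_trichotomy y v with hy | hy | hy
        · refine ⟨(x, y + 1), ?_, ?_⟩ <;> simp only [IsEdge, InGrid, and_true, true_and, and_self, true_or, or_true] <;> omega
        · omega
        · refine ⟨(x, y - 1), ?_, ?_⟩ <;> simp only [IsEdge, InGrid, and_true, true_and, and_self, true_or, or_true] <;> omega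
      · refine ⟨(x - 1, y), ?_, ?_⟩ <;> simp only [IsEdge, InGrid, and_true, true_and, and_self, true_or, or_true] <;> omega
    obtain ⟨k, hk, hn⟩ := key
    exact hV _ k hk (ih k hk.2.1 hn)

/-- if a polynomial conserved quantity vanishes at `μ` at one
vertex then it vanishes at `μ` everywhere, and dividing by `λ - μ` yields a
polynomial conserved quantity of lower degree. -/
theorem statement3 (m₁ m₂ n₁ n₂ : ℤ) (F : ℤ × ℤ → Fin 5 → ℝ)
    (a : ℤ × ℤ → ℤ × ℤ → ℝ) (N : ℕ)
    (hiso : IsIsothermic m₁ m₂ n₁ n₂ F a)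
    (P : ℤ × ℤ → ℕ → Fin 5 → ℝ) (hP : IsPCQ m₁ m₂ n₁ n₂ F a N P)
    (μ : ℝ) (hμ : ∀ i j, IsEdge m₁ m₂ n₁ n₂ i j → μ * a i j ≠ 1)
    (i₀ : ℤ × ℤ) (hi₀ : InGrid m₁ m₂ n₁ n₂ i₀)
    (hzero : pcqEval N P i₀ μ = 0) :
    (∀ j, InGrid m₁ m₂ n₁ n₂ j → pcqEval N P j μ = 0) ∧
    ∃ Pt : ℤ × ℤ → ℕ → Fin 5 → ℝ,
      IsPCQ m₁ m₂ n₁ n₂ F a (N - 1) Pt ∧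
      ∀ i, InGrid m₁ m₂ n₁ n₂ i → ∀ lam : ℝ,
        pcqEval N P i lam = (lam - μ) • pcqEval (N - 1) Pt i lam := by
  have hvan : ∀ j, InGrid m₁ m₂ n₁ n₂ j → pcqEval N P j μ = 0 := by
    intro j hj
    refine aux_van m₁ m₂ n₁ n₂ (fun j => pcqEval N P j μ = 0) ?_ i₀ hi₀ hzero _ j hj rfl
    intro i j hij h
    have := hP i j hij μ (hμ i j hij)
    change pcqEval N P j μ = 0 at h
    rw [this, h, Gamma_zero]
  refine ⟨hvan, ?_⟩
  have hdiv : ∃ Pt : ℤ × ℤ → ℕ → Fin 5 → ℝ, ∀ i, InGrid m₁ m₂ n₁ n₂ i → ∀ lam : ℝ,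
        pcqEval N P i lam = (lam - μ) • pcqEval (N - 1) Pt i lam := by
    rcases N with _ | n
    · refine ⟨fun _ _ => 0, fun i hi lam => ?_⟩
      have := hvan i hi
      simp [pcqEval] at this ⊢
      exact this
    · choose d r h using fun i => aux_div μ (n + 1) (P i)
      refine ⟨d, fun i hi lam => ?_⟩
      have h1 := h i μ
      have h2 := hvan i hi
      unfold pcqEval at h2 ⊢
      rw [h2, sub_self, zero_smul, zero_add] at h1
      rw [h i lam, ← h1, add_zero]
      rfl
  obtain ⟨Pt, hPt⟩ := hdiv
  refine ⟨Pt, ?_, hPt⟩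
  intro i j hij
  have hne : ∀ lam : ℝ, lam ≠ μ → lam * a i j ≠ 1 → pcqEval (N - 1) Pt i lam =
      Gamma (F i) (F j) (1 - lam * a i j) (pcqEval (N - 1) Pt j lam) := by
    intro lam h1 h2
    have h := hP i j hij lam h2
    rw [hPt i hij.1, hPt j hij.2.1, Gamma_smul] at h
    exact smul_right_injective _ (sub_ne_zero.2 h1) h
  intro lam hlam
  by_cases h : lam = μ
  swap
  · exact hne lam h hlam
  subst h
  have hq : (1 - lam * a i j) ≠ 0 := sub_ne_zero.2 (Ne.symm hlam)
  have ci := pcqEval_cont (N - 1) Pt i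
  have cj := pcqEval_cont (N - 1) Pt j
  have cR : ContinuousAt (fun l => Gamma (F i) (F j) (1 - l * a i j)
      (pcqEval (N - 1) Pt j l)) lam := by
    have cj' := cj.continuousAt (x := lam)
    unfold Gamma mink
    fun_prop (disch := assumption)
  have hev : ∀ᶠ l in nhdsWithin lam {lam}ᶜ, pcqEval (N - 1) Pt i l =
      Gamma (F i) (F j) (1 - l * a i j) (pcqEval (N - 1) Pt j l) := by
    have h1 : ∀ᶠ l in nhds lam, l * a i j ≠ 1 :=
      (ContinuousAt.eventually_ne (by fun_prop) hlam)
    filter_upwards [h1.filter_mono nhdsWithin_le_nhds, self_mem_nhdsWithin] with l h2 h3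
    exact hne l h3 h2
  have t1 := (ci.continuousAt (x := lam)).tendsto.mono_left
    (nhdsWithin_le_nhds (s := {lam}ᶜ))
  have t2 := cR.tendsto.mono_left (nhdsWithin_le_nhds (s := {lam}ᶜ))
  exact tendsto_nhds_unique (t1.congr' hev) t2
end
end

section
/- If P is a polynomial conserved quantity of a discrete isothermic net F, then the real polynomial λ ↦ ⟨P_i(λ),P_i(λ)⟩ is independent of the vertex i: ⟨P_i(λ),P_i(λ)⟩ = ⟨P_j(λ),P_j(λ)⟩ for all vertices i, j and all λ ∈ ℝ. In particular, ⟨P_i^{(N)},P_i^{(N)}⟩ and ⟨P_i^{(0)},P_i^{(0)}⟩ are independent of i, and for a linear conserved quantity P_i(λ) = λ·Z_i + Q_i also ⟨Z_i,Q_i⟩ is independent of i. -/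
noncomputable section

lemma mink_Gamma_self (p p' X : Fin 5 → ℝ) (q : ℝ) (hq : q ≠ 0)
    (hp : mink p p = 0) (hp' : mink p' p' = 0) :
    mink (Gamma p p' q X) (Gamma p p' q X) = mink X X := by
  have exp : ∀ s t : ℝ, mink (X + (s • p + t • p')) (X + (s • p + t • p'))
      = mink X X + s * s * mink p p + t * t * mink p' p' + 2 * s * mink X p
        + 2 * t * mink X p' + 2 * s * t * mink p p' := by
    intro s t
    simp only [mink, Pi.add_apply, Pi.smul_apply, smul_eq_mul]
    ring
  unfold Gamma
  by_cases h : mink p p' = 0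
  · simp [h]
  · rw [smul_add, smul_smul, smul_smul, exp, hp, hp']
    field_simp
    ring

open Polynomial in
/-- coordinate polynomial -/
def coordPoly (N : ℕ) (P : ℤ × ℤ → ℕ → Fin 5 → ℝ) (i : ℤ × ℤ) (c : Fin 5) : Polynomial ℝ :=
  ∑ k ∈ Finset.range (N + 1), C (P i k c) * X ^ k

/-- norm polynomial -/
def normPoly (N : ℕ) (P : ℤ × ℤ → ℕ → Fin 5 → ℝ) (i : ℤ × ℤ) : Polynomial ℝ :=
  -(coordPoly N P i 0 * coordPoly N P i 0) + coordPoly N P i 1 * coordPoly N P i 1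
    + coordPoly N P i 2 * coordPoly N P i 2 + coordPoly N P i 3 * coordPoly N P i 3
    + coordPoly N P i 4 * coordPoly N P i 4

lemma coordPoly_eval (N : ℕ) (P : ℤ × ℤ → ℕ → Fin 5 → ℝ) (i : ℤ × ℤ) (c : Fin 5) (x : ℝ) :
    (coordPoly N P i c).eval x = pcqEval N P i x c := by
  simp only [coordPoly, pcqEval, Polynomial.eval_finsetSum, Polynomial.eval_mul,
    Polynomial.eval_C, Polynomial.eval_pow, Polynomial.eval_X, Finset.sum_apply, Pi.smul_apply,
    smul_eq_mul]
  exact Finset.sum_congr rfl fun k _ => mul_comm _ _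

lemma normPoly_eval (N : ℕ) (P : ℤ × ℤ → ℕ → Fin 5 → ℝ) (i : ℤ × ℤ) (x : ℝ) :
    (normPoly N P i).eval x = mink (pcqEval N P i x) (pcqEval N P i x) := by
  simp [normPoly, mink, coordPoly_eval]

lemma coordPoly_natDegree (N : ℕ) (P : ℤ × ℤ → ℕ → Fin 5 → ℝ) (i : ℤ × ℤ) (c : Fin 5) :
    (coordPoly N P i c).natDegree ≤ N := by
  refine Polynomial.natDegree_sum_le_of_forall_le _ _ ?_
  intro k hk
  exact (Polynomial.natDegree_C_mul_X_pow_le _ _).trans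
    (Nat.lt_succ_iff.mp (Finset.mem_range.mp hk))

lemma coordPoly_coeff (N : ℕ) (P : ℤ × ℤ → ℕ → Fin 5 → ℝ) (i : ℤ × ℤ) (c : Fin 5) :
    (coordPoly N P i c).coeff N = P i N c := by
  simp [coordPoly, Polynomial.finset_sum_coeff, Polynomial.coeff_C_mul, Polynomial.coeff_X_pow]

lemma normPoly_coeff (N : ℕ) (P : ℤ × ℤ → ℕ → Fin 5 → ℝ) (i : ℤ × ℤ) :
    (normPoly N P i).coeff (N + N) = mink (P i N) (P i N) := by
  have h : ∀ c, (coordPoly N P i c * coordPoly N P i c).coeff (N + N) = P i N c * P i N c := by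
    intro c
    rw [Polynomial.coeff_mul_add_eq_of_natDegree_le (coordPoly_natDegree N P i c)
      (coordPoly_natDegree N P i c), coordPoly_coeff]
  simp only [normPoly, mink, Polynomial.coeff_add, Polynomial.coeff_neg, h]

lemma normPoly_edge {m₁ m₂ n₁ n₂ : ℤ} {F : ℤ × ℤ → Fin 5 → ℝ}
    {a : ℤ × ℤ → ℤ × ℤ → ℝ} {N : ℕ}
    (hiso : IsIsothermic m₁ m₂ n₁ n₂ F a)
    {P : ℤ × ℤ → ℕ → Fin 5 → ℝ} (hP : IsPCQ m₁ m₂ n₁ n₂ F a N P) (i j : ℤ × ℤ)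
    (e : IsEdge m₁ m₂ n₁ n₂ i j) : normPoly N P i = normPoly N P j := by
  apply Polynomial.eq_of_infinite_eval_eq
  refine Set.Infinite.mono ?_ (Set.finite_singleton (1 / a i j)).infinite_compl
  intro x hx
  have ha := hiso.nonzero i j e
  have hx' : x * a i j ≠ 1 := by
    intro h
    exact hx (by rw [Set.mem_singleton_iff, eq_div_iff ha, h])
  simp only [Set.mem_setOf_eq, normPoly_eval]
  rw [hP i j e x hx']
  exact mink_Gamma_self _ _ _ _ (sub_ne_zero.mpr (Ne.symm hx')) (hiso.lightcone i e.1).2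
    (hiso.lightcone j e.2.1).2

lemma normPoly_base {m₁ m₂ n₁ n₂ : ℤ} {F : ℤ × ℤ → Fin 5 → ℝ}
    {a : ℤ × ℤ → ℤ × ℤ → ℝ} {N : ℕ}
    (hiso : IsIsothermic m₁ m₂ n₁ n₂ F a)
    {P : ℤ × ℤ → ℕ → Fin 5 → ℝ} (hP : IsPCQ m₁ m₂ n₁ n₂ F a N P) (i : ℤ × ℤ)
    (hi : InGrid m₁ m₂ n₁ n₂ i) : normPoly N P i = normPoly N P (m₁, n₁) := by
  obtain ⟨m, n⟩ := i
  obtain ⟨h1, h2, h3, h4⟩ := hi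
  simp only at h1 h2 h3 h4
  have A : ∀ m, m₁ ≤ m → m ≤ m₂ → normPoly N P (m, n) = normPoly N P (m₁, n) := by
    intro m hm
    induction m, hm using Int.le_induction with
    | base => intro _; rfl
    | succ k hk ih =>
      intro h
      rw [← ih (by omega)]
      refine normPoly_edge hiso hP _ _ ⟨?_, ?_, ?_⟩ <;> simp [InGrid] <;> omega
  have B : ∀ n, n₁ ≤ n → n ≤ n₂ → normPoly N P (m₁, n) = normPoly N P (m₁, n₁) := by
    intro n hn
    induction n, hn using Int.le_induction with
    | base => intro _; rfl
    | succ k hk ih =>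
      intro h
      rw [← ih (by omega)]
      refine normPoly_edge hiso hP _ _ ⟨?_, ?_, ?_⟩ <;> simp [InGrid] <;> omega
  rw [A m h1 h2, B n h3 h4]

/-- the Minkowski square norm of a polynomial conserved quantity
is independent of the vertex; in particular so are the square norms of its top
and bottom coefficients, and for a linear conserved quantity `λ·Z + Q` also
`⟨Z,Q⟩` is independent of the vertex. -/
theorem statement5 (m₁ m₂ n₁ n₂ : ℤ) (F : ℤ × ℤ → Fin 5 → ℝ)
    (a : ℤ × ℤ → ℤ × ℤ → ℝ) (N : ℕ)
    (hiso : IsIsothermic m₁ m₂ n₁ n₂ F a)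
    (P : ℤ × ℤ → ℕ → Fin 5 → ℝ) (hP : IsPCQ m₁ m₂ n₁ n₂ F a N P) :
    ∀ i j, InGrid m₁ m₂ n₁ n₂ i → InGrid m₁ m₂ n₁ n₂ j →
      (∀ lam : ℝ,
        mink (pcqEval N P i lam) (pcqEval N P i lam)
          = mink (pcqEval N P j lam) (pcqEval N P j lam)) ∧
      mink (P i N) (P i N) = mink (P j N) (P j N) ∧
      mink (P i 0) (P i 0) = mink (P j 0) (P j 0) ∧
      (N = 1 → mink (P i 1) (P i 0) = mink (P j 1) (P j 0)) := by
  intro i j hi hj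
  have h : normPoly N P i = normPoly N P j :=
    (normPoly_base hiso hP i hi).trans (normPoly_base hiso hP j hj).symm
  have hl : ∀ lam : ℝ, mink (pcqEval N P i lam) (pcqEval N P i lam)
          = mink (pcqEval N P j lam) (pcqEval N P j lam) := by
    intro lam
    rw [← normPoly_eval, ← normPoly_eval, h]
  refine ⟨hl, ?_, ?_, ?_⟩
  · rw [← normPoly_coeff, ← normPoly_coeff, h]
  · have h0 := hl 0
    have z : ∀ i, pcqEval N P i 0 = P i 0 := by
      intro i
      simp [pcqEval, Finset.sum_range_succ']
    rwa [z, z] at h0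
  · rintro rfl
    have hp := hl 1
    have hm := hl (-1)
    simp only [pcqEval, Finset.sum_range_succ, Finset.sum_range_zero, mink, Pi.add_apply,
      Pi.smul_apply, smul_eq_mul, Pi.zero_apply, pow_zero, pow_one] at hp hm ⊢
    linarith
end
end

section
/- Let P be a polynomial conserved quantity of degree ≤ N (N ≥ 1) of a discrete isothermic net F whose top coefficient equals the light-cone lift itself, P^{(N)}_i = F_i for every vertex i. Then the quantity c := ⟨P_i^{(N−1)}, F_i⟩ is independent of the vertex i, and ⟨F_i,F_j⟩ = −c·a_{ij} on every edge (ij); in particular (when c ≠ 0) F is a Moutard lift of the net, i.e. ⟨F_i,F_j⟩ = ã_{ij} for the rescaled cross ratio factorizing function ã := −c·a. -/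
noncomputable section

lemma coeff_aux (N : ℕ) (hN : 1 ≤ N) (u v : ℕ → ℝ) (a b : ℝ)
    (h : ∀ x : ℝ, x * a ≠ 1 → ∑ k ∈ Finset.range (N + 1), x ^ k * u k
      = (1 - x * b) * ∑ k ∈ Finset.range (N + 1), x ^ k * v k) :
    u N = v N - b * v (N - 1) := by
  obtain ⟨M, rfl⟩ : ∃ M, N = M + 1 := ⟨N - 1, by omega⟩
  have key : (∑ k ∈ Finset.range (M + 1 + 1), Polynomial.C (u k) * Polynomial.X ^ k : Polynomial ℝ)
      = (∑ k ∈ Finset.range (M + 1 + 1), Polynomial.C (v k) * Polynomial.X ^ k)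
        - Polynomial.C b * ((∑ k ∈ Finset.range (M + 1 + 1), Polynomial.C (v k) * Polynomial.X ^ k)
          * Polynomial.X) := by
    apply Polynomial.eq_of_infinite_eval_eq
    have hfin : ({x : ℝ | x * a = 1}).Finite := by
      apply (Set.finite_singleton (a⁻¹)).subset
      intro x hx
      exact eq_inv_of_mul_eq_one_left hx
    refine hfin.infinite_compl.mono ?_
    intro x hx
    have := h x hx
    simp only [Set.mem_ofPred_eq, Polynomial.eval_sub, Polynomial.eval_mul, Polynomial.eval_finsetSum,
      Polynomial.eval_C, Polynomial.eval_pow, Polynomial.eval_X]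
    simp only [mul_comm (u _), mul_comm (v _)]
    rw [this]; ring
  have := congrArg (fun p => Polynomial.coeff p (M + 1)) key
  simpa [Polynomial.coeff_mul_X, Polynomial.finsetSum_coeff, Polynomial.coeff_C_mul,
    Polynomial.coeff_X_pow] using this

lemma mink_pcq (N : ℕ) (P : ℤ × ℤ → ℕ → Fin 5 → ℝ) (i : ℤ × ℤ) (x : ℝ) (y : Fin 5 → ℝ) :
    mink (pcqEval N P i x) y = ∑ k ∈ Finset.range (N + 1), x ^ k * mink (P i k) y := by
  simp only [mink, pcqEval, Finset.sum_apply, Pi.smul_apply, smul_eq_mul, Finset.sum_mul,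
    ← Finset.sum_neg_distrib, ← Finset.sum_add_distrib]
  apply Finset.sum_congr rfl
  intros
  ring

lemma mink_Gamma (p p' X : Fin 5 → ℝ) (q : ℝ) (h : mink p p' ≠ 0) (h' : mink p' p' = 0) :
    mink (Gamma p p' q X) p' = q * mink X p' := by
  have e : mink (Gamma p p' q X) p' = mink X p' + (1 / mink p p') *
      (((q - 1) * mink X p') * mink p p' + ((1 / q - 1) * mink X p) * mink p' p') := by
    unfold Gamma
    generalize 1 / mink p p' = A
    generalize (q - 1) * mink X p' = B
    generalize (1 / q - 1) * mink X p = C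
    simp only [mink, Pi.add_apply, Pi.smul_apply, smul_eq_mul]
    ring
  rw [e, h']
  field_simp
  ring

lemma edge_symm {m₁ m₂ n₁ n₂ : ℤ} {i j : ℤ × ℤ} (h : IsEdge m₁ m₂ n₁ n₂ i j) :
    IsEdge m₁ m₂ n₁ n₂ j i := by
  unfold IsEdge at *
  tauto

lemma not_prop_ne {x y : Fin 5 → ℝ} (h : ¬ Proportional x y) : x ≠ y := by
  rintro rfl
  exact h (Or.inl ⟨1, by simp⟩)

lemma edge_ne {m₁ m₂ n₁ n₂ : ℤ} (hm : m₁ < m₂) (hn : n₁ < n₂)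
    {F : ℤ × ℤ → Fin 5 → ℝ} {a : ℤ × ℤ → ℤ × ℤ → ℝ}
    (hiso : IsIsothermic m₁ m₂ n₁ n₂ F a) {i j : ℤ × ℤ} (h : IsEdge m₁ m₂ n₁ n₂ i j) :
    F i ≠ F j := by
  have H : ∀ x y : ℤ, m₁ ≤ x → x + 1 ≤ m₂ → n₁ ≤ y → y ≤ n₂ → F (x, y) ≠ F (x + 1, y) := by
    intro x y h1 h2 h3 h4
    by_cases hy : y < n₂
    · exact not_prop_ne (hiso.regular (x, y) (x+1, y) (x+1, y+1) (x, y+1)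
        ⟨⟨h1, by simp; omega, h3, h4⟩, ⟨by simp; omega, h2, by simp; omega, by simp; omega⟩,
          rfl, rfl, rfl⟩).1
    · have := not_prop_ne (hiso.regular (x, y-1) (x+1, y-1) (x+1, y-1+1) (x, y-1+1)
        ⟨⟨h1, by simp; omega, by simp; omega, by simp; omega⟩,
          ⟨by simp; omega, h2, by simp; omega, by simp; omega⟩,
          rfl, rfl, rfl⟩).2.2.2.2.2
      rw [sub_add_cancel] at this
      exact this.symm
  have V : ∀ x y : ℤ, m₁ ≤ x → x ≤ m₂ → n₁ ≤ y → y + 1 ≤ n₂ → F (x, y) ≠ F (x, y + 1) := by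
    intro x y h1 h2 h3 h4
    by_cases hy : x < m₂
    · exact not_prop_ne (hiso.regular (x, y) (x+1, y) (x+1, y+1) (x, y+1)
        ⟨⟨h1, h2, h3, by simp; omega⟩, ⟨by simp; omega, by simp; omega, by simp; omega, h4⟩,
          rfl, rfl, rfl⟩).2.2.1
    · have := not_prop_ne (hiso.regular (x-1, y) (x-1+1, y) (x-1+1, y+1) (x-1, y+1)
        ⟨⟨by simp; omega, by simp; omega, h3, by simp; omega⟩,
          ⟨by simp; omega, by simp; omega, by simp; omega, h4⟩,
          rfl, rfl, rfl⟩).2.2.2.1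
      rw [sub_add_cancel] at this
      exact this
  obtain ⟨x, y⟩ := i
  obtain ⟨z, w⟩ := j
  obtain ⟨⟨h1, h2, h3, h4⟩, ⟨h5, h6, h7, h8⟩, h⟩ := h
  simp only at h h1 h2 h3 h4 h5 h6 h7 h8
  rcases h with ⟨rfl, rfl⟩ | ⟨rfl, rfl⟩ | ⟨rfl, rfl⟩ | ⟨rfl, rfl⟩
  · exact H _ _ h1 h6 h3 h4
  · exact (H _ _ h5 h2 h3 h4).symm
  · exact V _ _ h1 h2 h3 h8
  · exact (V _ _ h1 h2 h7 h4).symm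

/-- if the top coefficient of a polynomial conserved quantity is
the light-cone lift `F` itself, then `F` is a Moutard lift: `⟨F_i,F_j⟩ = -c·a_{ij}`
for the constant `c = ⟨P^{(N-1)},F⟩`. -/
theorem statement9 (m₁ m₂ n₁ n₂ : ℤ) (hm : m₁ < m₂) (hn : n₁ < n₂)
    (F : ℤ × ℤ → Fin 5 → ℝ) (a : ℤ × ℤ → ℤ × ℤ → ℝ) (N : ℕ) (hN : 1 ≤ N)
    (hiso : IsIsothermic m₁ m₂ n₁ n₂ F a)
    (P : ℤ × ℤ → ℕ → Fin 5 → ℝ) (hP : IsPCQ m₁ m₂ n₁ n₂ F a N P)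
    (htop : ∀ i, InGrid m₁ m₂ n₁ n₂ i → P i N = F i) :
    ∃ c : ℝ,
      (∀ i, InGrid m₁ m₂ n₁ n₂ i → mink (P i (N - 1)) (F i) = c) ∧
      (∀ i j, IsEdge m₁ m₂ n₁ n₂ i j → mink (F i) (F j) = -c * a i j) := by
  have key : ∀ i j, IsEdge m₁ m₂ n₁ n₂ i j →
      mink (F i) (F j) = - mink (P j (N - 1)) (F j) * a i j := by
    intro i j hij
    have hs : mink (F i) (F j) ≠ 0 := by
      intro hs
      apply edge_ne hm hn hiso hij
      rw [← htop i hij.1, ← htop j hij.2.1]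
      funext c
      have := coeff_aux N hN (fun k => P i k c) (fun k => P j k c) (a i j) 0 (by
        intro x hx
        have := congrFun (hP i j hij x hx) c
        simpa [Gamma, hs, pcqEval] using this)
      simpa using this
    have h0 := (hiso.lightcone j hij.2.1).2
    have := coeff_aux N hN (fun k => mink (P i k) (F j)) (fun k => mink (P j k) (F j))
      (a i j) (a i j) (by
        intro x hx
        rw [← mink_pcq, ← mink_pcq, hP i j hij x hx, mink_Gamma _ _ _ _ hs h0])
    simp only [htop i hij.1, htop j hij.2.1, h0] at this
    rw [this]; ring
  have step : ∀ i j, IsEdge m₁ m₂ n₁ n₂ i j →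
      mink (P i (N - 1)) (F i) = mink (P j (N - 1)) (F j) := by
    intro i j hij
    have h1 := key i j hij
    have h2 := key j i (edge_symm hij)
    rw [mink_comm', h1, ← hiso.symm i j hij] at h2
    have := mul_right_cancel₀ (hiso.nonzero i j hij) h2
    linarith
  have hor : ∀ (k : ℕ), m₁ + k ≤ m₂ →
      mink (P (m₁ + k, n₁) (N - 1)) (F (m₁ + k, n₁)) = mink (P (m₁, n₁) (N - 1)) (F (m₁, n₁)) := by
    intro k
    induction k with
    | zero => intro _; simp
    | succ k ih =>
      intro hk
      push_cast at hk ⊢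
      rw [← ih (by omega)]
      apply step
      refine ⟨⟨?_, ?_, ?_, ?_⟩, ⟨?_, ?_, ?_, ?_⟩, Or.inr (Or.inl ⟨(add_assoc _ _ _).symm, rfl⟩)⟩ <;> simp only <;> omega
  have ver : ∀ (x : ℤ) (k : ℕ), m₁ ≤ x → x ≤ m₂ → n₁ + k ≤ n₂ →
      mink (P (x, n₁ + k) (N - 1)) (F (x, n₁ + k)) = mink (P (x, n₁) (N - 1)) (F (x, n₁)) := by
    intro x k hx1 hx2
    induction k with
    | zero => intro _; simp
    | succ k ih =>
      intro hk
      push_cast at hk ⊢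
      rw [← ih (by omega)]
      apply step
      refine ⟨⟨?_, ?_, ?_, ?_⟩, ⟨?_, ?_, ?_, ?_⟩, Or.inr (Or.inr (Or.inr ⟨rfl, (add_assoc _ _ _).symm⟩))⟩ <;> simp only <;> omega
  have all : ∀ i, InGrid m₁ m₂ n₁ n₂ i →
      mink (P i (N - 1)) (F i) = mink (P (m₁, n₁) (N - 1)) (F (m₁, n₁)) := by
    rintro ⟨x, y⟩ ⟨h1, h2, h3, h4⟩
    simp only at h1 h2 h3 h4
    obtain ⟨k, rfl⟩ := Int.le.dest h1
    obtain ⟨l, rfl⟩ := Int.le.dest h3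
    rw [ver _ l h1 h2 h4, hor k h2]
  refine ⟨_, all, ?_⟩
  intro i j hij
  rw [key i j hij, all j hij.2.1]
end
end

section
/- A discrete isothermic net F with cross ratio factorizing function a is special isothermic of type 0 — i.e. there exists a constant normalized conserved quantity, a vector Q ∈ ℝ^5 with ⟨Q,Q⟩ = 1 and Γ^λ_{ij}(Q) = Q for every edge (ij) and every λ ∈ ℝ with λ·a_{ij} ≠ 1 — if and only if F takes values in a fixed 2-sphere, i.e. there exists Q ∈ ℝ^5 with ⟨Q,Q⟩ = 1 and ⟨Q,F_i⟩ = 0 at every vertex i. -/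
noncomputable section

theorem aux_prop (x y : Fin 5 → ℝ) (hx : LightCone x) (hy : LightCone y)
    (h : mink x y = 0) : ∃ t : ℝ, y = t • x := by
  obtain ⟨hx0, hxx⟩ := hx
  obtain ⟨hy0, hyy⟩ := hy
  unfold mink at *
  have h0 : x 0 ≠ 0 := by
    intro h0
    rw [h0] at hxx
    apply hx0
    have h1 : x 1 = 0 := by nlinarith [sq_nonneg (x 1), sq_nonneg (x 2), sq_nonneg (x 3), sq_nonneg (x 4)]
    have h2 : x 2 = 0 := by nlinarith [sq_nonneg (x 1), sq_nonneg (x 2), sq_nonneg (x 3), sq_nonneg (x 4)]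
    have h3 : x 3 = 0 := by nlinarith [sq_nonneg (x 1), sq_nonneg (x 2), sq_nonneg (x 3), sq_nonneg (x 4)]
    have h4 : x 4 = 0 := by nlinarith [sq_nonneg (x 1), sq_nonneg (x 2), sq_nonneg (x 3), sq_nonneg (x 4)]
    ext k
    fin_cases k <;> simp [h0, h1, h2, h3, h4]
  obtain ⟨t, ht⟩ : ∃ t, y 0 = t * x 0 := ⟨y 0 / x 0, by field_simp⟩
  have key : (y 1 - t * x 1)^2 + (y 2 - t * x 2)^2 + (y 3 - t * x 3)^2 + (y 4 - t * x 4)^2 = 0 := by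
    rw [ht] at h hyy
    linear_combination hyy - 2 * t * h + t ^ 2 * hxx
  have e1 : (y 1 - t * x 1) = 0 := by
    apply pow_eq_zero_iff (two_ne_zero) |>.1
    linarith [sq_nonneg (y 1 - t * x 1), sq_nonneg (y 2 - t * x 2), sq_nonneg (y 3 - t * x 3), sq_nonneg (y 4 - t * x 4)]
  have e2 : (y 2 - t * x 2) = 0 := by
    apply pow_eq_zero_iff (two_ne_zero) |>.1
    linarith [sq_nonneg (y 1 - t * x 1), sq_nonneg (y 2 - t * x 2), sq_nonneg (y 3 - t * x 3), sq_nonneg (y 4 - t * x 4)]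
  have e3 : (y 3 - t * x 3) = 0 := by
    apply pow_eq_zero_iff (two_ne_zero) |>.1
    linarith [sq_nonneg (y 1 - t * x 1), sq_nonneg (y 2 - t * x 2), sq_nonneg (y 3 - t * x 3), sq_nonneg (y 4 - t * x 4)]
  have e4 : (y 4 - t * x 4) = 0 := by
    apply pow_eq_zero_iff (two_ne_zero) |>.1
    linarith [sq_nonneg (y 1 - t * x 1), sq_nonneg (y 2 - t * x 2), sq_nonneg (y 3 - t * x 3), sq_nonneg (y 4 - t * x 4)]
  refine ⟨t, ?_⟩
  ext k
  fin_cases k <;> simp <;> linarith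

theorem aux_smul (Q x : Fin 5 → ℝ) (t : ℝ) : mink Q (t • x) = t * mink Q x := by
  simp only [mink, Pi.smul_apply, smul_eq_mul]; ring

theorem aux_unit (x : Fin 5 → ℝ) : ∃ Q : Fin 5 → ℝ, mink Q Q = 1 ∧ mink Q x = 0 := by
  by_cases h : x 1 = 0
  · exact ⟨![0, 1, 0, 0, 0], by simp [mink], by simp [mink, h]⟩
  · have hp : 0 < x 1 ^ 2 + x 2 ^ 2 := by positivity
    have hs : Real.sqrt (x 1 ^ 2 + x 2 ^ 2) ^ 2 = x 1 ^ 2 + x 2 ^ 2 := Real.sq_sqrt hp.le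
    have hs0 : Real.sqrt (x 1 ^ 2 + x 2 ^ 2) ≠ 0 := (Real.sqrt_pos.2 hp).ne'
    set s := Real.sqrt (x 1 ^ 2 + x 2 ^ 2)
    refine ⟨![0, x 2 / s, - x 1 / s, 0, 0], ?_, ?_⟩
    · simp [mink]
      field_simp
      linarith
    · simp [mink]
      field_simp
      ring

theorem aux_orth (p p' Q : Fin 5 → ℝ) (hp : mink p p = 0) (hp' : mink p' p' = 0)
    (h : mink p p' ≠ 0) (hG : Gamma p p' (-1) Q = Q) : mink Q p = 0 ∧ mink Q p' = 0 := by
  have hv : ∀ k, mink Q p' * p k + mink Q p * p' k = 0 := by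
    intro k
    have := congrFun hG k
    simp only [Gamma, Pi.add_apply, Pi.smul_apply, smul_eq_mul] at this
    have h2 : (1 / mink p p') * (mink Q p' * p k + mink Q p * p' k) = 0 := by
      linear_combination (-1/2) * this
    exact (mul_eq_zero.1 h2).resolve_left (one_div_ne_zero h)
  generalize hA : mink Q p = A at *
  generalize hB : mink Q p' = B at *
  have h1 : A * mink p p' = 0 := by
    unfold mink at *
    linear_combination -p 0 * hv 0 + p 1 * hv 1 + p 2 * hv 2 + p 3 * hv 3 + p 4 * hv 4 - B * hp
  have h2 : B * mink p p' = 0 := by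
    unfold mink at *
    linear_combination -p' 0 * hv 0 + p' 1 * hv 1 + p' 2 * hv 2 + p' 3 * hv 3 + p' 4 * hv 4 - A * hp'
  exact ⟨(mul_eq_zero.1 h1).resolve_right h, (mul_eq_zero.1 h2).resolve_right h⟩

theorem aux_line (u v : ℤ) (R : ℤ → Prop)
    (h : ∀ m, u ≤ m → m + 1 ≤ v → (R m ↔ R (m + 1))) :
    ∀ m, u ≤ m → m ≤ v → (R u ↔ R m) := by
  intro m hm
  induction m, hm using Int.le_induction with
  | base => intro _; rfl
  | succ m hm ih => intro hv; exact (ih (by omega)).trans (h m hm hv)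

theorem aux_conn (m₁ m₂ n₁ n₂ : ℤ) (R : ℤ × ℤ → Prop)
    (h : ∀ i j, IsEdge m₁ m₂ n₁ n₂ i j → R i → R j) (i j : ℤ × ℤ)
    (hi : InGrid m₁ m₂ n₁ n₂ i) (hj : InGrid m₁ m₂ n₁ n₂ j) (hR : R i) : R j := by
  obtain ⟨a, b⟩ := i
  obtain ⟨c, d⟩ := j
  obtain ⟨h1, h2, h3, h4⟩ := hi
  obtain ⟨g1, g2, g3, g4⟩ := hj
  dsimp only at *
  have H := aux_line m₁ m₂ (fun m => R (m, b)) (fun m hm hm' =>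
    ⟨h (m, b) (m + 1, b) (by dsimp only [IsEdge, InGrid]; omega), h (m + 1, b) (m, b) (by dsimp only [IsEdge, InGrid]; omega)⟩)
  have V := aux_line n₁ n₂ (fun n => R (c, n)) (fun m hm hm' =>
    ⟨h (c, m) (c, m + 1) (by dsimp only [IsEdge, InGrid]; omega), h (c, m + 1) (c, m) (by dsimp only [IsEdge, InGrid]; omega)⟩)
  exact (V d g3 g4).1 ((V b h3 h4).2 ((H c g1 g2).1 ((H a h1 h2).2 hR)))

/-- a discrete isothermic net is special isothermic of type 0
(i.e. admits a constant normalized conserved quantity) if and only if it takes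
values in a fixed 2-sphere. -/
theorem statement11 (m₁ m₂ n₁ n₂ : ℤ) (F : ℤ × ℤ → Fin 5 → ℝ)
    (a : ℤ × ℤ → ℤ × ℤ → ℝ)
    (hiso : IsIsothermic m₁ m₂ n₁ n₂ F a) :
    (∃ Q : Fin 5 → ℝ, mink Q Q = 1 ∧
      ∀ i j, IsEdge m₁ m₂ n₁ n₂ i j → ∀ lam : ℝ, lam * a i j ≠ 1 →
        Gamma (F i) (F j) (1 - lam * a i j) Q = Q)
    ↔ (∃ Q : Fin 5 → ℝ, mink Q Q = 1 ∧
        ∀ i, InGrid m₁ m₂ n₁ n₂ i → mink Q (F i) = 0) := by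
  constructor
  · rintro ⟨Q, hQ, hG⟩
    have horth : ∀ i j, IsEdge m₁ m₂ n₁ n₂ i j → mink (F i) (F j) ≠ 0 →
        mink Q (F i) = 0 ∧ mink Q (F j) = 0 := by
      intro i j he hne
      have ha := hiso.nonzero i j he
      have hl : 2 / a i j * a i j = 2 := by field_simp
      have := hG i j he (2 / a i j) (by rw [hl]; norm_num)
      rw [hl] at this
      norm_num at this
      exact aux_orth _ _ _ (hiso.lightcone i he.1).2 (hiso.lightcone j he.2.1).2 hne this
    by_cases hex : ∃ i j, IsEdge m₁ m₂ n₁ n₂ i j ∧ mink (F i) (F j) ≠ 0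
    · obtain ⟨i, j, he, hne⟩ := hex
      refine ⟨Q, hQ, fun k hk => ?_⟩
      refine aux_conn m₁ m₂ n₁ n₂ (fun k => mink Q (F k) = 0) ?_ i k he.1 hk (horth i j he hne).1
      intro i j he h0
      by_cases hne : mink (F i) (F j) = 0
      · obtain ⟨t, ht⟩ := aux_prop _ _ (hiso.lightcone i he.1) (hiso.lightcone j he.2.1) hne
        simp only [ht, aux_smul, h0, mul_zero]
      · exact (horth i j he hne).2
    · push Not at hex
      by_cases hne : ∃ i, InGrid m₁ m₂ n₁ n₂ i
      · obtain ⟨i, hi⟩ := hne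
        obtain ⟨Q', hQ', hi0⟩ := aux_unit (F i)
        refine ⟨Q', hQ', fun k hk => ?_⟩
        refine aux_conn m₁ m₂ n₁ n₂ (fun k => mink Q' (F k) = 0) ?_ i k hi hk hi0
        intro i j he h0
        obtain ⟨t, ht⟩ := aux_prop _ _ (hiso.lightcone i he.1) (hiso.lightcone j he.2.1) (hex i j he)
        simp only [ht, aux_smul, h0, mul_zero]
      · exact ⟨Q, hQ, fun i hi => absurd ⟨i, hi⟩ hne⟩
  · rintro ⟨Q, hQ, h⟩
    refine ⟨Q, hQ, fun i j he lam _ => ?_⟩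
    simp [Gamma, h i he.1, h j he.2.1]
end
end
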